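/- Let L₁ and L₂ be locally compact Hausdorff spaces and let T : C₀⁺(L₁) → C₀⁺(L₂) be a surjective map satisfying ‖T(f+g)‖ = ‖T(f)+T(g)‖ for all f, g ∈ C₀⁺(L₁). Let f, g ∈ C₀⁺(L₁). If M_{T(f)} ∩ M_{T(g)} is non-empty, then M_{T(f+g)} = M_{T(f)} ∩ M_{T(g)}. -/

import Mathlib

open scoped ZeroAtInfty

lemma aux_le {X : Type*} [TopologicalSpace X] (K : C₀(X, ℝ)) (x : X) : K x ≤ ‖K‖ :=
  (le_abs_self _).trans (K.toBCF.norm_coe_le_norm x)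

lemma aux_norm_le {X : Type*} [TopologicalSpace X] (K : C₀(X, ℝ)) (h0 : ∀ x, 0 ≤ K x) {C : ℝ}
    (hC : 0 ≤ C) (h : ∀ x, K x ≤ C) : ‖K‖ ≤ C :=
  (BoundedContinuousFunction.norm_le (f := K.toBCF) hC).2 fun x => by
    show |K x| ≤ C
    rw [abs_of_nonneg (h0 x)]; exact h x

lemma aux_attain {X : Type*} [TopologicalSpace X] (K : C₀(X, ℝ)) (h0 : ∀ x, 0 ≤ K x)
    (hK : 0 < ‖K‖) : ∃ z, K z = ‖K‖ := by
  have : ∃ x, 0 < K x := by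
    by_contra! h
    have := aux_norm_le K h0 le_rfl h
    linarith
  obtain ⟨x, hx⟩ := this
  have hev : ∀ᶠ z in Filter.cocompact X, K z ≤ K x :=
    ((zero_at_infty K).eventually (gt_mem_nhds hx)).mono fun _ h => le_of_lt h
  obtain ⟨z, hz⟩ := (map_continuous K).exists_forall_ge' x hev
  exact ⟨z, le_antisymm (aux_le K z) (aux_norm_le K h0 (h0 z) hz)⟩

lemma aux_bump {X : Type*} [TopologicalSpace X] [LocallyCompactSpace X] [T2Space X]
    (y : X) (U : Set X) (hU : IsOpen U) (hy : y ∈ U) (e : ℝ) (he : 0 < e) :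
    ∃ H : C₀(X, ℝ), (∀ x, 0 ≤ H x) ∧ H y = e ∧ ‖H‖ = e ∧ ∀ x, x ∉ U → H x = 0 := by
  obtain ⟨φ, h1, h2, h3, h4⟩ := exists_continuous_one_zero_of_isCompact
    (isCompact_singleton (x := y)) hU.isClosed_compl (by simpa using hy)
  let H : C₀(X, ℝ) := e • ⟨φ, h3.is_zero_at_infty⟩
  have hH : ∀ x, H x = e * φ x := fun x => rfl
  have hHy : H y = e := by rw [hH, h1 rfl]; simp
  have hn : ∀ x, 0 ≤ H x := fun x => by rw [hH]; exact mul_nonneg he.le (h4 x).1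
  refine ⟨H, hn, hHy, le_antisymm (aux_norm_le H hn he.le fun x => ?_) ?_, fun x hx => ?_⟩
  · rw [hH]; nlinarith [(h4 x).2]
  · rw [← hHy]; exact aux_le H y
  · rw [hH, h2 hx]; simp

/-- A bump supported where `K` is small. -/
lemma aux_upper {X : Type*} [TopologicalSpace X]
    (K H : C₀(X, ℝ)) (hK : ∀ x, 0 ≤ K x) (hH : ∀ x, 0 ≤ H x) (e : ℝ) (hHe : ‖H‖ = e)
    (hs : ∀ x, H x ≠ 0 → K x ≤ ‖K‖ - e) : ‖K + H‖ ≤ ‖K‖ := by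
  refine aux_norm_le _ (fun x => add_nonneg (hK x) (hH x)) (norm_nonneg _) fun x => ?_
  show K x + H x ≤ _
  by_cases h : H x = 0
  · rw [h, add_zero]; exact aux_le K x
  · have := hs x h
    have := aux_le H x
    linarith

lemma aux_add {X : Type*} [TopologicalSpace X] (K H : C₀(X, ℝ)) (y : X)
    (h1 : K y = ‖K‖) (h2 : H y = ‖H‖) : ‖K + H‖ = ‖K‖ + ‖H‖ := by
  refine le_antisymm (norm_add_le _ _) ?_
  have : K y + H y ≤ ‖K + H‖ := aux_le (K + H) y
  linarith

lemma aux_sub {L₁ L₂ : Type*}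
    [TopologicalSpace L₁] [TopologicalSpace L₂] [LocallyCompactSpace L₂] [T2Space L₂]
    (T : C₀(L₁, ℝ) → C₀(L₂, ℝ))
    (hpos : ∀ f : C₀(L₁, ℝ), (∀ x, 0 ≤ f x) → ∀ y, 0 ≤ T f y)
    (hsurj : ∀ h : C₀(L₂, ℝ), (∀ y, 0 ≤ h y) →
      ∃ f : C₀(L₁, ℝ), (∀ x, 0 ≤ f x) ∧ T f = h)
    (hnorm : ∀ f g : C₀(L₁, ℝ), (∀ x, 0 ≤ f x) → (∀ x, 0 ≤ g x) →
      ‖T (f + g)‖ = ‖T f + T g‖)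
    (f g : C₀(L₁, ℝ)) (hf : ∀ x, 0 ≤ f x) (hg : ∀ x, 0 ≤ g x)
    (hadd : ‖T (f + g)‖ = ‖T f‖ + ‖T g‖) (y : L₂) (hy : T (f + g) y = ‖T (f + g)‖) :
    T f y = ‖T f‖ := by
  by_contra hne
  have hlt : T f y < ‖T f‖ := lt_of_le_of_ne (aux_le _ y) hne
  obtain ⟨H, hH0, hHy, hHn, hHs⟩ := aux_bump y {x | T f x < ‖T f‖ - (‖T f‖ - T f y) / 2}
    (isOpen_lt (map_continuous _) continuous_const)
    (by show T f y < _; linarith) ((‖T f‖ - T f y) / 2) (by linarith)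
  obtain ⟨h, hh, rfl⟩ := hsurj H hH0
  have h1 : ‖T f + T h‖ ≤ ‖T f‖ := aux_upper _ _ (hpos f hf) hH0 _ hHn fun x hx => by
    by_contra hc
    exact hx (hHs x fun hm => hc (le_of_lt hm))
  have h2 := aux_add _ _ y hy (hHy.trans hHn.symm)
  rw [← hnorm _ _ (fun x => add_nonneg (hf x) (hg x)) hh] at h2
  have e : f + g + h = f + h + g := by abel
  rw [e, hnorm _ _ (fun x => add_nonneg (hf x) (hh x)) hg] at h2
  have h3 := norm_add_le (T (f + h)) (T g)
  rw [hnorm f h hf hh] at h3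
  linarith

theorem stmt_11 {L₁ L₂ : Type*}
    [TopologicalSpace L₁] [LocallyCompactSpace L₁] [T2Space L₁]
    [TopologicalSpace L₂] [LocallyCompactSpace L₂] [T2Space L₂]
    (T : C₀(L₁, ℝ) → C₀(L₂, ℝ))
    (hpos : ∀ f : C₀(L₁, ℝ), (∀ x, 0 ≤ f x) → ∀ y, 0 ≤ T f y)
    (hsurj : ∀ h : C₀(L₂, ℝ), (∀ y, 0 ≤ h y) →
      ∃ f : C₀(L₁, ℝ), (∀ x, 0 ≤ f x) ∧ T f = h)
    (hnorm : ∀ f g : C₀(L₁, ℝ), (∀ x, 0 ≤ f x) → (∀ x, 0 ≤ g x) →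
      ‖T (f + g)‖ = ‖T f + T g‖)
    (f g : C₀(L₁, ℝ)) (hf : ∀ x, 0 ≤ f x) (hg : ∀ x, 0 ≤ g x)
    (hne : ({y : L₂ | T f y = ‖T f‖} ∩ {y : L₂ | T g y = ‖T g‖}).Nonempty) :
    {y : L₂ | T (f + g) y = ‖T (f + g)‖} =
      {y : L₂ | T f y = ‖T f‖} ∩ {y : L₂ | T g y = ‖T g‖} := by
  obtain ⟨w, hw1, hw2⟩ := hne
  have hadd : ‖T (f + g)‖ = ‖T f‖ + ‖T g‖ := by
    rw [hnorm f g hf hg]; exact aux_add _ _ w hw1 hw2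
  have hfg : ∀ x, 0 ≤ (f + g) x := fun x => add_nonneg (hf x) (hg x)
  ext y
  constructor
  · intro hy
    refine ⟨aux_sub T hpos hsurj hnorm f g hf hg hadd y hy, ?_⟩
    refine aux_sub T hpos hsurj hnorm g f hg hf ?_ y ?_
    · rw [add_comm g f, hadd, add_comm]
    · rw [add_comm g f]; exact hy
  · rintro ⟨hy1, hy2⟩
    simp only [Set.mem_setOf_eq] at hy1 hy2 ⊢
    by_contra hne
    have hlt : T (f + g) y < ‖T (f + g)‖ := lt_of_le_of_ne (aux_le _ y) hne
    obtain ⟨e, he⟩ : ∃ e, e = (‖T (f + g)‖ - T (f + g) y) / 2 := ⟨_, rfl⟩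
    have he0 : 0 < e := by linarith
    obtain ⟨H, hH0, hHy, hHn, hHs⟩ := aux_bump y
      ({x | T (f + g) x < ‖T (f + g)‖ - e} ∩ {x | ‖T f‖ - e / 2 < T f x})
      ((isOpen_lt (map_continuous _) continuous_const).inter
        (isOpen_lt continuous_const (map_continuous _)))
      ⟨by show T (f + g) y < _; linarith, by show _ < T f y; linarith⟩ e he0
    obtain ⟨h, hh, rfl⟩ := hsurj H hH0
    have h1 : ‖T (f + g) + T h‖ ≤ ‖T (f + g)‖ :=
      aux_upper _ _ (hpos _ hfg) hH0 _ hHn fun x hx => by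
        by_contra hc
        exact hx (hHs x fun hm => hc (le_of_lt hm.1))
    have hhg : ∀ x, 0 ≤ (h + g) x := fun x => add_nonneg (hh x) (hg x)
    have hn : ‖T (h + g)‖ = ‖T h‖ + ‖T g‖ := by
      rw [hnorm h g hh hg]; exact aux_add _ _ y (hHy.trans hHn.symm) hy2
    obtain ⟨z, hz⟩ := aux_attain (T (h + g)) (hpos _ hhg)
      (by rw [hn, hHn]; linarith [norm_nonneg (T g)])
    have hzh := aux_sub T hpos hsurj hnorm h g hh hg hn z hz
    have hzf : ‖T f‖ - e / 2 < T f z := by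
      by_contra hc
      have := hHs z fun hm => hc hm.2
      linarith
    have h2 : T f z + T (h + g) z ≤ ‖T f + T (h + g)‖ := aux_le (T f + T (h + g)) z
    have e1 : f + (h + g) = f + g + h := by abel
    rw [← hnorm _ _ hf hhg, e1, hnorm _ _ hfg hh] at h2
    linarith
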